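/- Let u ∈ H^1(R^d × T) and write u(x,y) = Σ_k e^{iky} u_k(x) as a Fourier series in y, with m(u) = u_0 the zero mode. Then ‖u − m(u)‖_{L^{2(d+1)/(d−1)}(R^d×T)} ≲ ‖∂_y u‖_{L^2}^{1/(d+1)} ‖∇_x u‖_{L^2}^{d/(d+1)}. -/

import Mathlib

open MeasureTheory Real Set

noncomputable section

abbrev Edim (d : ℕ) := EuclideanSpace ℝ (Fin d)

/-- A fundamental domain `ℝ^d × (0, 2π]` representing `ℝ^d × 𝕋`. -/
def strip (d : ℕ) : Set (Edim d × ℝ) := Set.univ ×ˢ Set.Ioc 0 (2 * π)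

/-- `M(u) = ‖u‖₂²` over `ℝ^d × 𝕋`. -/
def massF (d : ℕ) (u : Edim d × ℝ → ℂ) : ℝ := ∫ z in strip d, ‖u z‖ ^ 2

/-- `‖∇ₓ u‖₂²` over `ℝ^d × 𝕋`. -/
def gradxSq (d : ℕ) (u : Edim d × ℝ → ℂ) : ℝ :=
  ∫ z in strip d, ∑ i : Fin d, ‖fderiv ℝ u z (EuclideanSpace.single i 1, 0)‖ ^ 2

/-- `‖∂_y u‖₂²` over `ℝ^d × 𝕋`. -/
def gradySq (d : ℕ) (u : Edim d × ℝ → ℂ) : ℝ :=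
  ∫ z in strip d, ‖fderiv ℝ u z (0, 1)‖ ^ 2

/-- `‖u‖_p^p` over `ℝ^d × 𝕋`. -/
def lpPow (d : ℕ) (u : Edim d × ℝ → ℂ) (p : ℝ) : ℝ := ∫ z in strip d, ‖u z‖ ^ p

/-- The exponent `2 + 4/(d-1)`. -/
def qExp (d : ℕ) : ℝ := 2 + 4 / ((d : ℝ) - 1)

/-- The energy `E(u)`. -/
def energyF (d : ℕ) (u : Edim d × ℝ → ℂ) : ℝ :=
  (1 / 2) * (gradxSq d u + gradySq d u)
    - (((d : ℝ) - 1) / (2 * ((d : ℝ) + 1))) * lpPow d u (qExp d)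

/-- The semivirial `K(u)`. -/
def KF (d : ℕ) (u : Edim d × ℝ → ℂ) : ℝ :=
  gradxSq d u - ((d : ℝ) / ((d : ℝ) + 1)) * lpPow d u (qExp d)

/-- The functional `I(u)`. -/
def IF (d : ℕ) (u : Edim d × ℝ → ℂ) : ℝ :=
  (1 / 2) * gradySq d u + (1 / (2 * ((d : ℝ) + 1))) * lpPow d u (qExp d)

/-- Membership in `H¹(ℝ^d × 𝕋)`: `2π`-periodicity in `y`, differentiability, and
integrability of `|u|²`, `|∇u|²` and `|u|^q` on a fundamental domain. -/
def InH1 (d : ℕ) (u : Edim d × ℝ → ℂ) : Prop :=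
  (∀ x y, u (x, y + 2 * π) = u (x, y)) ∧ Differentiable ℝ u ∧
  IntegrableOn (fun z => ‖u z‖ ^ 2) (strip d) ∧
  IntegrableOn (fun z => ‖fderiv ℝ u z‖ ^ 2) (strip d) ∧
  IntegrableOn (fun z => ‖u z‖ ^ qExp d) (strip d)

/-- `m_c`, the infimum of the energy on the semivirial-vanishing manifold with mass `c`. -/
def mGround (d : ℕ) (c : ℝ) : ℝ :=
  sInf {e | ∃ u, InH1 d u ∧ massF d u = c ∧ KF d u = 0 ∧ energyF d u = e}

end

noncomputable section

/-- The zero Fourier mode in `y`: `m(u)(x) = (2π)⁻¹ ∫_𝕋 u(x,y) dy`. -/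
def meanY (d : ℕ) (u : Edim d × ℝ → ℂ) : Edim d × ℝ → ℂ :=
  fun z => (2 * π : ℝ)⁻¹ • ∫ y in (0:ℝ)..(2 * π), u (z.1, y)

open scoped ENNReal

/-- A differentiable function on the line is bounded by its total variation, provided it is
integrable; the integrability is encoded by the extra summand, whose weight is arbitrary. -/
lemma enorm_le_lintegral_enorm_deriv_add {G : ℝ → ℝ} (hG : Differentiable ℝ G) {ε : ℝ≥0∞}
    (hε : ε ≠ 0) (s : ℝ) : ‖G s‖ₑ ≤ ∫⁻ t, (‖deriv G t‖ₑ + ε * ‖G t‖ₑ) := by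
  have hm : Measurable fun t => ‖deriv G t‖ₑ := (measurable_deriv G).enorm
  rw [lintegral_add_left hm, lintegral_const_mul _ hG.continuous.measurable.enorm]
  by_cases h1 : ∫⁻ t, ‖deriv G t‖ₑ = ∞
  · simp [h1]
  by_cases h2 : ∫⁻ t, ‖G t‖ₑ = ∞
  · simp [h2, ENNReal.mul_top hε]
  have i1 : Integrable (deriv G) :=
    ⟨(measurable_deriv G).aestronglyMeasurable, lt_top_iff_ne_top.2 h1⟩
  have i2 : Integrable G := ⟨hG.continuous.aestronglyMeasurable, lt_top_iff_ne_top.2 h2⟩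
  have hlim := tendsto_zero_of_hasDerivAt_of_integrableOn_Iic (a := s)
    (fun x _ => (hG x).hasDerivAt) i1.integrableOn i2.integrableOn
  have hint := integral_Iic_of_hasDerivAt_of_tendsto' (a := s)
    (fun x _ => (hG x).hasDerivAt) i1.integrableOn hlim
  rw [sub_zero] at hint
  rw [← hint]
  exact (enorm_integral_le_lintegral_enorm _).trans
    ((setLIntegral_le_lintegral _ _).trans le_self_add)

lemma enorm_le_setLIntegral_enorm_deriv {G : ℝ → ℝ} (hG : Differentiable ℝ G) {T c s : ℝ}
    (hc : c ∈ Icc 0 T) (hs : s ∈ Icc 0 T) (hGc : G c = 0) :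
    ‖G s‖ₑ ≤ ∫⁻ t in Ioc 0 T, ‖deriv G t‖ₑ := by
  by_cases h1 : ∫⁻ t in Ioc 0 T, ‖deriv G t‖ₑ = ∞
  · simp [h1]
  have hsub : uIoc c s ⊆ Ioc 0 T := Ioc_subset_Ioc (le_min hc.1 hs.1) (max_le hc.2 hs.2)
  have i1 : IntegrableOn (deriv G) (Ioc 0 T) :=
    ⟨(measurable_deriv G).aestronglyMeasurable, lt_top_iff_ne_top.2 h1⟩
  have hint := intervalIntegral.integral_eq_sub_of_hasDerivAt (a := c) (b := s)
    (fun x _ => (hG x).hasDerivAt) (intervalIntegrable_iff.2 (i1.mono_set hsub))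
  rw [hGc, sub_zero] at hint
  have : ‖G s‖ₑ = ‖∫ t in uIoc c s, deriv G t‖ₑ := by
    rw [← hint, ← ofReal_norm, ← ofReal_norm, intervalIntegral.norm_intervalIntegral_eq]
  rw [this]
  exact (enorm_integral_le_lintegral_enorm _).trans (lintegral_mono_set hsub)

lemma volume_restrict_strip (d : ℕ) :
    (volume : Measure (Edim d × ℝ)).restrict (strip d)
      = (volume : Measure (Edim d)).prod (volume.restrict (Ioc 0 (2 * π))) := by
  rw [strip, Measure.volume_eq_prod, ← Measure.prod_restrict, Measure.restrict_univ]

/-- The factors of the product measure on `Fin (d + 1) → ℝ` modelling `ℝ^d × 𝕋`; the periodic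
variable has index `0`. -/
def stripFactor (d : ℕ) (i : Fin (d + 1)) : Measure ℝ :=
  if i = 0 then volume.restrict (Ioc 0 (2 * π)) else volume

instance (d : ℕ) (i : Fin (d + 1)) : SigmaFinite (stripFactor d i) := by
  unfold stripFactor; split_ifs <;> infer_instance

/-- Coordinates on `ℝ^d × ℝ`, the last variable having index `0`. -/
def stripCoord (d : ℕ) (z : Fin (d + 1) → ℝ) : Edim d × ℝ :=
  (WithLp.toLp 2 fun j => z j.succ, z 0)

lemma measurePreserving_stripCoord (d : ℕ) :
    MeasurePreserving (stripCoord d) (Measure.pi (stripFactor d)) (volume.restrict (strip d)) := by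
  have h1 := measurePreserving_piFinSuccAbove (stripFactor d) 0
  have e0 : stripFactor d 0 = volume.restrict (Ioc 0 (2 * π)) := by simp [stripFactor]
  have e1 : (Measure.pi fun j : Fin d => stripFactor d (Fin.succAbove 0 j)) = volume := by
    simp [stripFactor, volume_pi]
  rw [e0, e1] at h1
  have h2 := (MeasurePreserving.id (volume.restrict (Ioc 0 (2 * π)))).prod
    (PiLp.volume_preserving_toLp (Fin d))
  have h3 := (Measure.measurePreserving_swap.comp h2).comp h1
  rw [volume_restrict_strip]
  exact h3

lemma stripCoord_update_zero (d : ℕ) (z : Fin (d + 1) → ℝ) (t : ℝ) :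
    stripCoord d (Function.update z 0 t) = ((stripCoord d z).1, t) := by
  simp [stripCoord]

lemma stripCoord_update_succ (d : ℕ) (z : Fin (d + 1) → ℝ) (i : Fin d) (t : ℝ) :
    stripCoord d (Function.update z i.succ t)
      = stripCoord d z + (t - z i.succ) • (EuclideanSpace.single i 1, 0) := by
  refine Prod.ext ?_ ?_
  · ext j
    by_cases h : j = i
    · subst h; simp [stripCoord]
    · simp [stripCoord, h]
  · simp [stripCoord, Function.update_of_ne (Fin.succ_ne_zero i).symm]

/-- Anisotropic Gagliardo–Nirenberg–Sobolev inequality for `L¹` gradients on the strip, in terms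
of a majorant of the weighted directional derivatives. -/
lemma lintegral_rpow_le_of_enorm_fderiv_le {d : ℕ} (hd : 2 ≤ d) {H : Edim d × ℝ → ℝ}
    (hH : Differentiable ℝ H) (hper : ∀ x y, H (x, y + 2 * π) = H (x, y))
    (hzero : ∀ x, ∃ c ∈ Icc 0 (2 * π), H (x, c) = 0) {ε l : ℝ≥0∞} (hε : ε ≠ 0) (hl : l ≠ ∞)
    {f : Edim d × ℝ → ℝ≥0∞} (hf : Measurable f) (hy : ∀ z, ‖fderiv ℝ H z (0, 1)‖ₑ ≤ f z)
    (hx : ∀ i z, l * (‖fderiv ℝ H z (EuclideanSpace.single i 1, 0)‖ₑ + ε * ‖H z‖ₑ) ≤ f z) :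
    l * ∫⁻ z in strip d, ‖H z‖ₑ ^ (((d : ℝ) + 1) / d)
      ≤ (∫⁻ z in strip d, f z) ^ (((d : ℝ) + 1) / d) := by
  have hd0 : (0 : ℝ) < d := by positivity
  have hmp := measurePreserving_stripCoord d
  rw [← hmp.lintegral_comp hf, ← hmp.lintegral_comp (hH.continuous.measurable.enorm.pow_const _),
    ← lintegral_const_mul' _ _ hl]
  have hconj : Real.HolderConjugate (Fintype.card (Fin (d + 1)) : ℝ) (((d : ℝ) + 1) / d) := by
    rw [Real.holderConjugate_iff]
    simp only [Fintype.card_fin]; push_cast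
    exact ⟨by linarith, by field_simp; ring⟩
  refine le_trans (lintegral_mono fun z => ?_)
    (lintegral_prod_lintegral_pow_le (stripFactor d) hconj (hf.comp hmp.measurable))
  have key0 : ‖H (stripCoord d z)‖ₑ
      ≤ ∫⁻ t, f (stripCoord d (Function.update z 0 t)) ∂stripFactor d 0 := by
    have hp : Function.Periodic (fun y => H ((stripCoord d z).1, y)) (2 * π) := fun y => hper _ _
    obtain ⟨s, hs, hsz⟩ := hp.exists_mem_Ioc two_pi_pos (stripCoord d z).2 0
    obtain ⟨c, hc, hcz⟩ := hzero (stripCoord d z).1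
    rw [zero_add] at hs
    have hder : ∀ t, HasDerivAt (fun y => H ((stripCoord d z).1, y))
        (fderiv ℝ H ((stripCoord d z).1, t) (0, 1)) t := fun t =>
      (hH _).hasFDerivAt.comp_hasDerivAt t ((hasDerivAt_const t _).prodMk (hasDerivAt_id t))
    have := enorm_le_setLIntegral_enorm_deriv (fun t => (hder t).differentiableAt) hc
      (Ioc_subset_Icc_self hs) hcz
    simp only [stripFactor, if_true, stripCoord_update_zero]
    rw [show H (stripCoord d z) = H ((stripCoord d z).1, s) from hsz]
    refine this.trans (lintegral_mono fun t => ?_)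
    rw [(hder t).deriv]
    exact hy _
  have key1 : ∀ i : Fin d, l * ‖H (stripCoord d z)‖ₑ
      ≤ ∫⁻ t, f (stripCoord d (Function.update z i.succ t)) ∂stripFactor d i.succ := by
    intro i
    set e : Edim d × ℝ := (EuclideanSpace.single i 1, 0)
    have hder : ∀ t, HasDerivAt (fun t => H (stripCoord d z + (t - z i.succ) • e))
        (fderiv ℝ H (stripCoord d z + (t - z i.succ) • e) e) t := fun t =>
      (hH _).hasFDerivAt.comp_hasDerivAt t (by
        simpa using (((hasDerivAt_id t).sub_const (z i.succ)).smul_const e).const_add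
          (stripCoord d z))
    have := enorm_le_lintegral_enorm_deriv_add (fun t => (hder t).differentiableAt) hε (z i.succ)
    simp only [stripFactor, Fin.succ_ne_zero, if_false, stripCoord_update_succ]
    rw [sub_self, zero_smul, add_zero] at this
    refine (mul_le_mul_right this l).trans ?_
    rw [← lintegral_const_mul' _ _ hl]
    refine lintegral_mono fun t => ?_
    rw [(hder t).deriv]
    exact hx i _
  have hexp : (1 : ℝ) / ((Fintype.card (Fin (d + 1)) : ℝ) - 1) = 1 / d := by simp
  rw [hexp, Fin.prod_univ_succ]
  calc l * ‖H (stripCoord d z)‖ₑ ^ (((d : ℝ) + 1) / d)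
      = ‖H (stripCoord d z)‖ₑ ^ ((1 : ℝ) / d)
        * ∏ _i : Fin d, (l * ‖H (stripCoord d z)‖ₑ) ^ ((1 : ℝ) / d) := by
        rw [Finset.prod_const, Finset.card_univ, Fintype.card_fin, ← ENNReal.rpow_natCast,
          ← ENNReal.rpow_mul, one_div_mul_cancel hd0.ne', ENNReal.rpow_one, add_div,
          div_self hd0.ne', ENNReal.rpow_add_of_nonneg _ _ zero_le_one (by positivity),
          ENNReal.rpow_one]
        ring
    _ ≤ _ := by
        refine mul_le_mul' (ENNReal.rpow_le_rpow key0 (by positivity))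
          (Finset.prod_le_prod' fun i _ => ENNReal.rpow_le_rpow (key1 i) (by positivity))

lemma two_lt_qExp {d : ℕ} (hd : 2 ≤ d) : 2 < qExp d := by
  have : (2 : ℝ) ≤ d := by exact_mod_cast hd
  have : (0 : ℝ) < 4 / ((d : ℝ) - 1) := div_pos (by norm_num) (by linarith)
  unfold qExp; linarith

lemma qExp_half_add_one_mul {d : ℕ} (hd : 2 ≤ d) :
    (qExp d / 2 + 1) * (((d : ℝ) + 1) / d) = qExp d := by
  have h2 : (2 : ℝ) ≤ d := by exact_mod_cast hd
  have h1 : (d : ℝ) - 1 ≠ 0 := by linarith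
  have h0 : (d : ℝ) ≠ 0 := by linarith
  unfold qExp; field_simp; ring

lemma one_div_qExp {d : ℕ} (hd : 2 ≤ d) : 1 / qExp d = (d : ℝ) / (d + 1) - 1 / 2 := by
  have h2 : (2 : ℝ) ≤ d := by exact_mod_cast hd
  have h1 : (d : ℝ) - 1 ≠ 0 := by linarith
  have h3 : (d : ℝ) + 1 ≠ 0 := by linarith
  have h4 : qExp d = 2 * (d + 1) / (d - 1) := by unfold qExp; field_simp; ring
  rw [h4]; field_simp; ring

lemma rpow_one_div_qExp_le {d : ℕ} (hd : 2 ≤ d) {Q A B K : ℝ} (hQ : 0 ≤ Q) (hA : 0 < A)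
    (hB : 0 < B) (hK : 0 < K)
    (h : A / B * Q ≤ (K * Q ^ (1 / 2 : ℝ) * A) ^ (((d : ℝ) + 1) / d)) :
    Q ^ (1 / qExp d) ≤ K * A ^ (1 / ((d : ℝ) + 1)) * B ^ ((d : ℝ) / (d + 1)) := by
  have h2 : (2 : ℝ) ≤ d := by exact_mod_cast hd
  have hd0 : (0 : ℝ) < d := by linarith
  rcases hQ.eq_or_lt with rfl | hQ
  · rw [zero_rpow (one_div_pos.2 (by linarith [two_lt_qExp hd])).ne']; positivity
  have h' := rpow_le_rpow (by positivity) h (show 0 ≤ (d : ℝ) / (d + 1) by positivity)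
  rw [← rpow_mul (by positivity),
    show ((d : ℝ) + 1) / d * (d / (d + 1)) = 1 by field_simp, rpow_one,
    mul_rpow (by positivity) hQ.le, div_rpow hA.le hB.le] at h'
  have e1 : (1 : ℝ) / (d + 1) = 1 - d / (d + 1) := by field_simp; ring
  rw [one_div_qExp hd, rpow_sub hQ, e1, rpow_sub hA, rpow_one, div_le_iff₀ (by positivity)]
  have hAp : 0 < A ^ ((d : ℝ) / (d + 1)) := by positivity
  have hBp : 0 < B ^ ((d : ℝ) / (d + 1)) := by positivity
  rw [div_mul_eq_mul_div, div_le_iff₀ hBp] at h'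
  rw [show K * (A / A ^ ((d : ℝ) / (d + 1))) * B ^ ((d : ℝ) / (d + 1)) * Q ^ (1 / 2 : ℝ)
    = (K * Q ^ (1 / 2 : ℝ) * A * B ^ ((d : ℝ) / (d + 1))) / A ^ ((d : ℝ) / (d + 1)) by ring,
    le_div_iff₀ hAp, mul_comm]
  exact h'

lemma enorm_fderiv_abs_rpow_apply_le {E : Type*} [NormedAddCommGroup E] [NormedSpace ℝ E]
    {v : E → ℝ} (hv : Differentiable ℝ v) {r : ℝ} (hr : 0 < r) (z e : E) :
    ‖fderiv ℝ (fun z => |v z| ^ (r + 1)) z e‖ₑ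
      ≤ ENNReal.ofReal (r + 1) * ‖v z‖ₑ ^ r * ‖fderiv ℝ v z e‖ₑ := by
  have h := ((hasDerivAt_abs_rpow (v z) (show 1 < r + 1 by linarith)).comp_hasFDerivAt z
    (hv z).hasFDerivAt).fderiv
  have h' : fderiv ℝ (fun z => |v z| ^ (r + 1)) z
    = ((r + 1) * |v z| ^ (r + 1 - 2) * v z) • fderiv ℝ v z := h
  rw [h', smul_apply, enorm_smul]
  refine mul_le_mul_left (le_of_eq ?_) _
  rw [← ofReal_norm, ← ofReal_norm, ENNReal.ofReal_rpow_of_nonneg (norm_nonneg _) hr.le,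
    ← ENNReal.ofReal_mul (by positivity)]
  congr 1
  rw [norm_mul, norm_mul, norm_of_nonneg (by positivity : 0 ≤ r + 1),
    norm_of_nonneg (by positivity : 0 ≤ |v z| ^ (r + 1 - 2)), Real.norm_eq_abs, mul_assoc]
  congr 1
  rcases eq_or_ne (v z) 0 with h0 | h0
  · simp [h0, hr.ne']
  · rw [← rpow_add_one (abs_pos.2 h0).ne']; ring_nf

lemma lintegral_rpow_mul_le_sqrt {α : Type*} [MeasurableSpace α] {μ : Measure α}
    {v a : α → ℝ≥0∞} (hv : Measurable v) (ha : Measurable a) (q : ℝ) :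
    ∫⁻ z, v z ^ (q / 2) * a z ∂μ
      ≤ (∫⁻ z, v z ^ q ∂μ) ^ (1 / 2 : ℝ) * (∫⁻ z, a z ^ (2 : ℝ) ∂μ) ^ (1 / 2 : ℝ) := by
  refine (ENNReal.lintegral_mul_le_Lp_mul_Lq μ Real.HolderConjugate.two_two
    (hv.pow_const (q / 2)).aemeasurable ha.aemeasurable).trans_eq ?_
  simp only [← ENNReal.rpow_mul, div_mul_cancel₀ q (two_ne_zero' ℝ)]

lemma lintegral_rpow_ne_top_of_le_of_le {α : Type*} [MeasurableSpace α] {μ : Measure α}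
    {v : α → ℝ≥0∞} (hv : Measurable v) {p r q : ℝ} (hpr : p ≤ r) (hrq : r ≤ q)
    (hp : ∫⁻ z, v z ^ p ∂μ ≠ ∞) (hq : ∫⁻ z, v z ^ q ∂μ ≠ ∞) : ∫⁻ z, v z ^ r ∂μ ≠ ∞ := by
  refine ne_top_of_le_ne_top (ENNReal.add_ne_top.2 ⟨hp, hq⟩) ?_
  rw [← lintegral_add_left (hv.pow_const p)]
  refine lintegral_mono fun z => ?_
  rcases le_total (v z) 1 with h | h
  · exact (ENNReal.rpow_le_rpow_of_exponent_ge h hpr).trans le_self_add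
  · exact (ENNReal.rpow_le_rpow_of_exponent_le h hrq).trans le_add_self

/-- Anisotropic Sobolev inequality on the strip for functions vanishing somewhere on every
vertical line. -/
lemma lintegral_enorm_rpow_qExp_le {d : ℕ} (hd : 2 ≤ d) {v : Edim d × ℝ → ℝ}
    (hv : Differentiable ℝ v) (hper : ∀ x y, v (x, y + 2 * π) = v (x, y))
    (hzero : ∀ x, ∃ c ∈ Icc 0 (2 * π), v (x, c) = 0)
    (h2 : ∫⁻ z in strip d, ‖v z‖ₑ ^ (2 : ℝ) ≠ ∞) (hq : ∫⁻ z in strip d, ‖v z‖ₑ ^ qExp d ≠ ∞)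
    {a b : Edim d × ℝ → ℝ≥0∞} (ha : Measurable a) (hb : Measurable b)
    (hva : ∀ z, ‖fderiv ℝ v z (0, 1)‖ₑ ≤ a z)
    (hvb : ∀ i z, ‖fderiv ℝ v z (EuclideanSpace.single i 1, 0)‖ₑ ≤ b z)
    {A B : ℝ} (hA : 0 < A) (hB : 0 < B)
    (haA : (∫⁻ z in strip d, a z ^ (2 : ℝ)) ^ (1 / 2 : ℝ) ≤ ENNReal.ofReal A)
    (hbB : (∫⁻ z in strip d, b z ^ (2 : ℝ)) ^ (1 / 2 : ℝ) ≤ ENNReal.ofReal B) :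
    (∫⁻ z in strip d, ‖v z‖ₑ ^ qExp d) ^ (1 / qExp d)
      ≤ ENNReal.ofReal ((qExp d + 2) * A ^ (1 / ((d : ℝ) + 1)) * B ^ ((d : ℝ) / (d + 1))) := by
  have hq2 := two_lt_qExp hd
  have hdr : (2 : ℝ) ≤ d := by exact_mod_cast hd
  have hmv : Measurable fun z => ‖v z‖ₑ := hv.continuous.measurable.enorm
  set r : ℝ := qExp d / 2 with hr
  have hr0 : 0 < r := by linarith
  have hM : ∫⁻ z in strip d, ‖v z‖ₑ ^ (r + 1) ≠ ∞ :=
    lintegral_rpow_ne_top_of_le_of_le hmv (by linarith) (by linarith) h2 hq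
  set M : ℝ := (∫⁻ z in strip d, ‖v z‖ₑ ^ (r + 1)).toReal with hMdef
  set Q : ℝ := (∫⁻ z in strip d, ‖v z‖ₑ ^ qExp d).toReal with hQdef
  have hQ0 : 0 ≤ Q := ENNReal.toReal_nonneg
  have hM0 : 0 ≤ M := ENNReal.toReal_nonneg
  have hQe : ∫⁻ z in strip d, ‖v z‖ₑ ^ qExp d = ENNReal.ofReal Q := (ENNReal.ofReal_toReal hq).symm
  have hMe : ∫⁻ z in strip d, ‖v z‖ₑ ^ (r + 1) = ENNReal.ofReal M :=
    (ENNReal.ofReal_toReal hM).symm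
  have hH : ∀ z, ‖|v z| ^ (r + 1)‖ₑ = ‖v z‖ₑ ^ (r + 1) := fun z => by
    rw [← ofReal_norm (v z), ENNReal.ofReal_rpow_of_nonneg (norm_nonneg _) (by linarith),
      Real.norm_eq_abs, enorm_eq_ofReal (by positivity)]
  have step : ∀ ε : ℝ, 0 < ε → A / B * Q
      ≤ ((qExp d + 2) * Q ^ (1 / 2 : ℝ) * A + ε * (A / B * M)) ^ (((d : ℝ) + 1) / d) := by
    intro ε hε
    set l : ℝ≥0∞ := ENNReal.ofReal (A / B) with hl
    have key := lintegral_rpow_le_of_enorm_fderiv_le hd (H := fun z => |v z| ^ (r + 1))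
      (fun z => ((hasDerivAt_abs_rpow (v z) (by linarith)).comp_hasFDerivAt z
        (hv z).hasFDerivAt).differentiableAt)
      (fun x y => by simp only [hper])
      (fun x => by
        obtain ⟨c, hc, hc0⟩ := hzero x
        exact ⟨c, hc, by simp only [hc0, abs_zero, zero_rpow (by linarith : r + 1 ≠ 0)]⟩)
      (ε := ENNReal.ofReal ε) (l := l) (by simpa using hε) ENNReal.ofReal_ne_top
      (f := fun z => ENNReal.ofReal (r + 1) * (‖v z‖ₑ ^ r * a z)
        + (l * (ENNReal.ofReal (r + 1) * (‖v z‖ₑ ^ r * b z))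
          + l * (ENNReal.ofReal ε * ‖v z‖ₑ ^ (r + 1))))
      (by fun_prop)
      (fun z => by
        refine (enorm_fderiv_abs_rpow_apply_le hv hr0 z _).trans (le_trans ?_ le_self_add)
        rw [mul_assoc]; gcongr; exact hva z)
      (fun i z => by
        refine le_trans ?_ le_add_self
        rw [mul_add, hH]
        gcongr
        refine (enorm_fderiv_abs_rpow_apply_le hv hr0 z _).trans ?_
        rw [mul_assoc]; gcongr; exact hvb i z)
    simp only [hH, ← ENNReal.rpow_mul] at key
    rw [qExp_half_add_one_mul hd, hQe, ← ENNReal.ofReal_mul (by positivity)] at key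
    have bd : (∫⁻ z in strip d, (ENNReal.ofReal (r + 1) * (‖v z‖ₑ ^ r * a z)
        + (l * (ENNReal.ofReal (r + 1) * (‖v z‖ₑ ^ r * b z))
          + l * (ENNReal.ofReal ε * ‖v z‖ₑ ^ (r + 1)))))
        ≤ ENNReal.ofReal ((qExp d + 2) * Q ^ (1 / 2 : ℝ) * A + ε * (A / B * M)) := by
      have e1 := (lintegral_rpow_mul_le_sqrt (μ := volume.restrict (strip d)) hmv ha (qExp d)).trans
        (mul_le_mul_right haA _)
      have e2 := (lintegral_rpow_mul_le_sqrt (μ := volume.restrict (strip d)) hmv hb (qExp d)).trans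
        (mul_le_mul_right hbB _)
      rw [hQe, ENNReal.ofReal_rpow_of_nonneg hQ0 (by norm_num),
        ← ENNReal.ofReal_mul (by positivity)] at e1 e2
      rw [lintegral_add_left (by fun_prop), lintegral_add_left (by fun_prop),
        lintegral_const_mul _ (by fun_prop), lintegral_const_mul _ (by fun_prop),
        lintegral_const_mul _ (by fun_prop), lintegral_const_mul _ (by fun_prop),
        lintegral_const_mul _ (by fun_prop), hMe]
      refine (add_le_add (mul_le_mul_right e1 _)
        (add_le_add (mul_le_mul_right (mul_le_mul_right e2 _) _) le_rfl)).trans_eq ?_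
      rw [hl]
      simp (disch := positivity) only [← ENNReal.ofReal_mul, ← ENNReal.ofReal_add]
      congr 1
      rw [hr]; field_simp; ring
    have key' := key.trans (ENNReal.rpow_le_rpow bd (by positivity))
    rwa [ENNReal.ofReal_rpow_of_nonneg (by positivity) (by positivity),
      ENNReal.ofReal_le_ofReal_iff (by positivity)] at key'
  have hlim : Filter.Tendsto
      (fun ε : ℝ => ((qExp d + 2) * Q ^ (1 / 2 : ℝ) * A + ε * (A / B * M)) ^ (((d : ℝ) + 1) / d))
      (nhdsWithin 0 (Ioi 0)) (nhds (((qExp d + 2) * Q ^ (1 / 2 : ℝ) * A) ^ (((d : ℝ) + 1) / d))) := by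
    have hc : Continuous (fun ε : ℝ =>
        ((qExp d + 2) * Q ^ (1 / 2 : ℝ) * A + ε * (A / B * M)) ^ (((d : ℝ) + 1) / d)) :=
      Continuous.rpow_const (by fun_prop) fun _ => Or.inr (by positivity)
    simpa using (hc.tendsto 0).mono_left nhdsWithin_le_nhds
  have fin := ge_of_tendsto hlim (Filter.eventually_of_mem self_mem_nhdsWithin step)
  rw [hQe, ENNReal.ofReal_rpow_of_nonneg hQ0 (by positivity)]
  exact ENNReal.ofReal_le_ofReal (rpow_one_div_qExp_le hd hQ0 hA hB (by linarith) fin)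

lemma Function.Periodic.setLIntegral_Ioc_comp_add {f : ℝ → ℝ≥0∞} {T : ℝ}
    (hf : Function.Periodic f T) (hT : 0 < T) (h : ℝ) :
    ∫⁻ y in Ioc 0 T, f (y + h) = ∫⁻ y in Ioc 0 T, f y := by
  have h1 : ∫⁻ y in Ioc 0 T, f (y + h) = ∫⁻ y in Ioc h (h + T), f y := by
    have := (measurePreserving_add_right volume h).setLIntegral_comp_preimage_emb
      (measurableEmbedding_addRight h) f (Ioc h (h + T))
    rw [← this]
    simp
  rw [h1]
  have := (isAddFundamentalDomain_Ioc hT h).setLIntegral_eq (isAddFundamentalDomain_Ioc hT 0) f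
    hf.map_vadd_zmultiples
  rwa [zero_add] at this

lemma setLIntegral_strip_comp_add {d : ℕ} {f : Edim d × ℝ → ℝ≥0∞} (hf : Measurable f)
    (hper : ∀ z, f (z + (0, 2 * π)) = f z) (h : ℝ) :
    ∫⁻ z in strip d, f (z + (0, h)) = ∫⁻ z in strip d, f z := by
  rw [volume_restrict_strip, lintegral_prod _ (by fun_prop), lintegral_prod _ (by fun_prop)]
  refine lintegral_congr fun x => ?_
  have hp : Function.Periodic (fun y => f (x, y)) (2 * π) := fun y => by
    simpa using hper (x, y)
  simpa using hp.setLIntegral_Ioc_comp_add two_pi_pos h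

lemma lintegral_strip_add_shift_rpow_le {d : ℕ} {f : Edim d × ℝ → ℝ≥0∞} (hf : Measurable f)
    (hper : ∀ z, f (z + (0, 2 * π)) = f z) (h : ℝ) {p : ℝ} (hp : 1 ≤ p) :
    (∫⁻ z in strip d, (f z + f (z + (0, h))) ^ p) ^ (1 / p)
      ≤ 2 * (∫⁻ z in strip d, f z ^ p) ^ (1 / p) := by
  refine (ENNReal.lintegral_Lp_add_le hf.aemeasurable
    (show Measurable fun z => f (z + (0, h)) by fun_prop).aemeasurable hp).trans_eq ?_
  rw [setLIntegral_strip_comp_add (hf.pow_const p) (fun z => by simp only [hper]) h, two_mul]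

lemma lintegral_enorm_rpow_of_integrableOn {α F : Type*} [MeasurableSpace α] {μ : Measure α}
    [NormedAddCommGroup F] {f : α → F} {p : ℝ} (hp : 0 ≤ p)
    (hf : Integrable (fun z => ‖f z‖ ^ p) μ) :
    ∫⁻ z, ‖f z‖ₑ ^ p ∂μ = ENNReal.ofReal (∫ z, ‖f z‖ ^ p ∂μ) := by
  rw [ofReal_integral_eq_lintegral_ofReal hf (Filter.Eventually.of_forall fun z => by positivity)]
  refine lintegral_congr fun z => ?_
  rw [← ofReal_norm, ENNReal.ofReal_rpow_of_nonneg (norm_nonneg _) hp]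

lemma integrable_sq_clm_apply {α E F : Type*} [MeasurableSpace α] {μ : Measure α}
    [NormedAddCommGroup E] [NormedSpace ℝ E] [NormedAddCommGroup F] [NormedSpace ℝ F]
    {T : α → E →L[ℝ] F} (hT : Integrable (fun z => ‖T z‖ ^ 2) μ) (e : E)
    (hm : AEStronglyMeasurable (fun z => T z e) μ) : Integrable (fun z => ‖T z e‖ ^ 2) μ := by
  refine (hT.mul_const (‖e‖ ^ 2)).mono' (hm.norm.pow 2) (Filter.Eventually.of_forall fun z => ?_)
  rw [norm_of_nonneg (by positivity), ← mul_pow]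
  gcongr
  exact (T z).le_opNorm e

/-- A real component of a vertical difference vanishes somewhere on every period. -/
lemma exists_eq_zero_of_periodic_sub {g : ℝ → ℝ} (hg : Continuous g) {T : ℝ} (hT : 0 < T)
    (hper : Function.Periodic g T) (h : ℝ) : ∃ c ∈ Icc 0 T, g c - g (c + h) = 0 := by
  have hc : Continuous fun y => g y - g (y + h) := by fun_prop
  have hint : ∀ a b, IntervalIntegrable g volume a b := fun a b => hg.intervalIntegrable a b
  have h0 : ∫ y in (0 : ℝ)..T, (g y - g (y + h)) = 0 := by
    rw [intervalIntegral.integral_sub (hint _ _)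
      ((show Continuous fun y => g (y + h) by fun_prop).intervalIntegrable _ _),
      intervalIntegral.integral_comp_add_right, zero_add, add_comm T h,
      hper.intervalIntegral_add_eq h 0, zero_add, sub_self]
  have hd : ∀ x, HasDerivAt (fun x => ∫ y in (0 : ℝ)..x, (g y - g (y + h))) (g x - g (x + h)) x :=
    fun x => hc.integral_hasStrictDerivAt 0 x |>.hasDerivAt
  obtain ⟨c, hcm, hc0⟩ := exists_hasDerivAt_eq_zero hT
    (fun x _ => (hd x).continuousAt.continuousWithinAt) (by simp [h0]) (fun x _ => hd x)
  exact ⟨c, Ioo_subset_Icc_self hcm, hc0⟩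

/-- The interpolation inequality for a real component of the vertical difference
`u(x, y) - u(x, y + h)`. -/
lemma lintegral_component_sub_shift_le {d : ℕ} (hd : 2 ≤ d) {u : Edim d × ℝ → ℂ} (hu : InH1 d u)
    {A B : ℝ} (hA : 0 < A) (hB : 0 < B) (hyA : gradySq d u ^ (1 / 2 : ℝ) ≤ A)
    (hxB : gradxSq d u ^ (1 / 2 : ℝ) ≤ B) (h : ℝ) (L : ℂ →L[ℝ] ℝ) (hL : ∀ c, ‖L c‖ₑ ≤ ‖c‖ₑ) :
    (∫⁻ z in strip d, ‖L (u z - u (z + (0, h)))‖ₑ ^ qExp d) ^ (1 / qExp d)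
      ≤ ENNReal.ofReal
        ((qExp d + 2) * (2 * A) ^ (1 / ((d : ℝ) + 1)) * (2 * B) ^ ((d : ℝ) / (d + 1))) := by
  obtain ⟨hper, hdiff, hL2, hD2, hLq⟩ := hu
  have hq2 := two_lt_qExp hd
  have hper' : ∀ z, u (z + (0, 2 * π)) = u z := fun z => by
    have := hper z.1 z.2
    rwa [show (z.1, z.2 + 2 * π) = z + (0, 2 * π) by ext <;> simp] at this
  have hD : ∀ z, fderiv ℝ u (z + (0, 2 * π)) = fderiv ℝ u z := fun z => by
    rw [← fderiv_comp_add_right]; simp only [hper']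
  have hum : Measurable fun z => ‖u z‖ₑ := hdiff.continuous.measurable.enorm
  have hDm : ∀ e, Measurable fun z => fderiv ℝ u z e := fun e => measurable_fderiv_apply_const ℝ u e
  have hDi : ∀ e, Integrable (fun z => ‖fderiv ℝ u z e‖ ^ 2) (volume.restrict (strip d)) :=
    fun e => integrable_sq_clm_apply hD2 e (hDm e).aestronglyMeasurable
  set a : Edim d × ℝ → ℝ≥0∞ := fun z => ‖fderiv ℝ u z (0, 1)‖ₑ with ha
  set b : Edim d × ℝ → ℝ≥0∞ := fun z =>
    (∑ i : Fin d, ‖fderiv ℝ u z (EuclideanSpace.single i 1, 0)‖ₑ ^ (2 : ℝ)) ^ (1 / 2 : ℝ) with hb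
  have ham : Measurable a := (hDm _).enorm
  have hbm : Measurable b :=
    (Finset.measurable_sum _ fun i _ => (hDm _).enorm.pow_const _).pow_const _
  have haA : (∫⁻ z in strip d, a z ^ (2 : ℝ)) ^ (1 / 2 : ℝ) ≤ ENNReal.ofReal A := by
    rw [lintegral_enorm_rpow_of_integrableOn zero_le_two (by simpa using hDi (0, 1)),
      ENNReal.ofReal_rpow_of_nonneg (by positivity) (by positivity)]
    simpa [gradySq] using ENNReal.ofReal_le_ofReal hyA
  have hbB : (∫⁻ z in strip d, b z ^ (2 : ℝ)) ^ (1 / 2 : ℝ) ≤ ENNReal.ofReal B := by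
    have e : ∀ z, b z ^ (2 : ℝ) = ENNReal.ofReal
        (∑ i : Fin d, ‖fderiv ℝ u z (EuclideanSpace.single i 1, 0)‖ ^ 2) := fun z => by
      rw [hb, ← ENNReal.rpow_mul, one_div_mul_cancel two_ne_zero, ENNReal.rpow_one,
        ENNReal.ofReal_sum_of_nonneg fun i _ => by positivity]
      refine Finset.sum_congr rfl fun i _ => ?_
      rw [ENNReal.ofReal_pow (norm_nonneg _), ofReal_norm, ENNReal.rpow_two]
    simp only [e]
    rw [← ofReal_integral_eq_lintegral_ofReal (integrable_finsetSum _ fun i _ => hDi _)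
      (Filter.Eventually.of_forall fun z => by positivity)]
    rw [ENNReal.ofReal_rpow_of_nonneg (by positivity) (by positivity)]
    exact ENNReal.ofReal_le_ofReal hxB
  have hshift : Differentiable ℝ fun z => u (z + (0, h)) :=
    hdiff.comp (differentiable_id.add_const _)
  have hw : Differentiable ℝ fun z => u z - u (z + (0, h)) := hdiff.sub hshift
  have hDv : ∀ z e, ‖fderiv ℝ (fun z => L (u z - u (z + (0, h)))) z e‖ₑ
      ≤ ‖fderiv ℝ u z e‖ₑ + ‖fderiv ℝ u (z + (0, h)) e‖ₑ := fun z e => by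
    have e1 : fderiv ℝ (fun z => L (u z - u (z + (0, h)))) z
        = L.comp (fderiv ℝ u z - fderiv ℝ u (z + (0, h))) := by
      have := (L.hasFDerivAt.comp z (hw z).hasFDerivAt).fderiv
      rw [fderiv_fun_sub (hdiff z) (hshift z), fderiv_comp_add_right] at this
      exact this
    rw [e1]
    exact (hL _).trans enorm_sub_le
  have hvle : ∀ z, ‖L (u z - u (z + (0, h)))‖ₑ ≤ ‖u z‖ₑ + ‖u (z + (0, h))‖ₑ := fun z =>
    (hL _).trans enorm_sub_le
  have hfin : ∀ p : ℝ, 1 ≤ p → Integrable (fun z => ‖u z‖ ^ p) (volume.restrict (strip d)) →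
      ∫⁻ z in strip d, ‖L (u z - u (z + (0, h)))‖ₑ ^ p ≠ ∞ := fun p hp hi => by
    have h1 := lintegral_strip_add_shift_rpow_le hum (fun z => by rw [hper']) h hp
    rw [lintegral_enorm_rpow_of_integrableOn (by linarith) hi] at h1
    have h2 : (∫⁻ z in strip d, (‖u z‖ₑ + ‖u (z + (0, h))‖ₑ) ^ p) ^ (1 / p) < ∞ :=
      h1.trans_lt (ENNReal.mul_lt_top (by simp)
        (ENNReal.rpow_lt_top_of_nonneg (by positivity) ENNReal.ofReal_ne_top))
    rw [ENNReal.rpow_lt_top_iff_of_pos (by positivity)] at h2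
    exact ne_top_of_le_ne_top h2.ne
      (lintegral_mono fun z => ENNReal.rpow_le_rpow (hvle z) (by linarith))
  have two_ofReal : ∀ x : ℝ, 2 * ENNReal.ofReal x = ENNReal.ofReal (2 * x) := fun x => by
    rw [ENNReal.ofReal_mul zero_le_two]; simp
  refine lintegral_enorm_rpow_qExp_le hd (L.differentiable.comp hw) ?_ ?_
    (hfin 2 one_le_two (by simpa [IntegrableOn] using hL2)) (hfin _ (by linarith) hLq)
    (a := fun z => a z + a (z + (0, h))) (b := fun z => b z + b (z + (0, h)))
    (by fun_prop) (by fun_prop) (fun z => hDv z _) (fun i z => (hDv z _).trans ?_)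
    (by positivity) (by positivity) ?_ ?_
  · intro x y
    have e : ((x, y + 2 * π) : Edim d × ℝ) + (0, h) = (x, y + h) + (0, 2 * π) := by
      ext <;> simp; ring
    simp [e, hper]
  · intro x
    have hc : Continuous fun y => L (u (x, y)) := by
      have := hdiff.continuous; fun_prop
    obtain ⟨c, hc, hc0⟩ := exists_eq_zero_of_periodic_sub hc two_pi_pos
      (fun y => by simp only [hper]) h
    exact ⟨c, hc, by simpa using hc0⟩
  · have hle : ∀ z, ‖fderiv ℝ u z (EuclideanSpace.single i 1, 0)‖ₑ ≤ b z := fun z => by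
      rw [hb, one_div, ENNReal.le_rpow_inv_iff two_pos]
      exact Finset.single_le_sum
        (f := fun i => ‖fderiv ℝ u z (EuclideanSpace.single i 1, 0)‖ₑ ^ (2 : ℝ))
        (fun _ _ => zero_le) (Finset.mem_univ i)
    exact add_le_add (hle _) (hle _)
  · refine (lintegral_strip_add_shift_rpow_le ham (fun z => by simp only [ha, hD]) h
      one_le_two).trans ?_
    rw [← two_ofReal]; gcongr
  · refine (lintegral_strip_add_shift_rpow_le hbm (fun z => by simp only [hb, hD]) h
      one_le_two).trans ?_
    rw [← two_ofReal]; gcongr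

lemma lintegral_sub_shift_le {d : ℕ} (hd : 2 ≤ d) {u : Edim d × ℝ → ℂ} (hu : InH1 d u)
    {A B : ℝ} (hA : 0 < A) (hB : 0 < B) (hyA : gradySq d u ^ (1 / 2 : ℝ) ≤ A)
    (hxB : gradxSq d u ^ (1 / 2 : ℝ) ≤ B) (h : ℝ) :
    ∫⁻ z in strip d, ‖u z - u (z + (0, h))‖ₑ ^ qExp d
      ≤ ENNReal.ofReal
        (4 * (qExp d + 2) * A ^ (1 / ((d : ℝ) + 1)) * B ^ ((d : ℝ) / (d + 1))) ^ qExp d := by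
  have hq2 := two_lt_qExp hd
  have hd0 : (0 : ℝ) < d := by positivity
  have hre := lintegral_component_sub_shift_le hd hu hA hB hyA hxB h Complex.reCLM fun c => by
    rw [← ofReal_norm, ← ofReal_norm]
    exact ENNReal.ofReal_le_ofReal (Complex.abs_re_le_norm c)
  have him := lintegral_component_sub_shift_le hd hu hA hB hyA hxB h Complex.imCLM fun c => by
    rw [← ofReal_norm, ← ofReal_norm]
    exact ENNReal.ofReal_le_ofReal (Complex.abs_im_le_norm c)
  have hw : Continuous fun z => u z - u (z + (0, h)) := by
    have := hu.2.1.continuous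
    fun_prop
  have hpt : ∀ c : ℂ, ‖c‖ₑ ≤ ‖Complex.reCLM c‖ₑ + ‖Complex.imCLM c‖ₑ := fun c => by
    simp only [← ofReal_norm]
    rw [← ENNReal.ofReal_add (norm_nonneg _) (norm_nonneg _)]
    exact ENNReal.ofReal_le_ofReal (Complex.norm_le_abs_re_add_abs_im c)
  rw [← ENNReal.rpow_inv_le_iff (by linarith), ← one_div]
  calc (∫⁻ z in strip d, ‖u z - u (z + (0, h))‖ₑ ^ qExp d) ^ (1 / qExp d)
      ≤ (∫⁻ z in strip d, ((fun z => ‖Complex.reCLM (u z - u (z + (0, h)))‖ₑ)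
          + fun z => ‖Complex.imCLM (u z - u (z + (0, h)))‖ₑ) z ^ qExp d) ^ (1 / qExp d) := by
        gcongr
        exact hpt _
    _ ≤ _ := ENNReal.lintegral_Lp_add_le
        (Complex.reCLM.continuous.comp hw).measurable.enorm.aemeasurable
        (Complex.imCLM.continuous.comp hw).measurable.enorm.aemeasurable (by linarith)
    _ ≤ _ := add_le_add hre him
    _ = _ := by
        rw [← ENNReal.ofReal_add (by positivity) (by positivity),
          mul_rpow zero_le_two hA.le, mul_rpow zero_le_two hB.le]
        congr 1
        have h2 : (2 : ℝ) ^ (1 / ((d : ℝ) + 1)) * 2 ^ ((d : ℝ) / (d + 1)) = 2 := by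
          rw [← rpow_add two_pos, ← add_div, add_comm, div_self (by positivity), rpow_one]
        linear_combination 2 * (qExp d + 2) * A ^ (1 / ((d : ℝ) + 1)) * B ^ ((d : ℝ) / (d + 1)) * h2

/-- The normalized Lebesgue measure on a period. -/
def periodMeasure : Measure ℝ := (ENNReal.ofReal (2 * π))⁻¹ • volume.restrict (Ioc 0 (2 * π))

instance : IsProbabilityMeasure periodMeasure := by
  refine ⟨?_⟩
  simp only [periodMeasure, Measure.smul_apply, Measure.restrict_apply_univ, Real.volume_Ioc,
    sub_zero, smul_eq_mul]
  exact ENNReal.inv_mul_cancel (by simpa using pi_pos) ENNReal.ofReal_ne_top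

lemma integrable_periodMeasure {g : ℝ → ℂ} (hg : Continuous g) : Integrable g periodMeasure := by
  refine Integrable.smul_measure ?_ (by simpa using pi_pos)
  exact (hg.integrableOn_Icc (a := 0) (b := 2 * π)).mono_set Ioc_subset_Icc_self

/-- The mean-free part is the average of the vertical differences. -/
lemma sub_meanY_eq_integral {d : ℕ} {u : Edim d × ℝ → ℂ} (hu : Continuous u)
    (hper : ∀ x y, u (x, y + 2 * π) = u (x, y)) (z : Edim d × ℝ) :
    u z - meanY d u z = ∫ h, (u z - u (z + (0, h))) ∂periodMeasure := by
  rw [integral_sub (integrable_const _) (integrable_periodMeasure (by fun_prop)), integral_const,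
    probReal_univ, one_smul]
  congr 1
  have hp : Function.Periodic (fun y => u (z.1, y)) (2 * π) := hper z.1
  have e1 : ∫ y in (0 : ℝ)..(2 * π), u (z.1, y) = ∫ y in (0 : ℝ)..(2 * π), u (z + (0, y)) := by
    have e2 : ∀ y, u (z + (0, y)) = u (z.1, z.2 + y) := fun y => by
      congr 1; ext <;> simp
    simp only [e2]
    rw [intervalIntegral.integral_comp_add_left (fun y => u (z.1, y)), add_zero,
      hp.intervalIntegral_add_eq z.2 0, zero_add]
  rw [meanY, e1, periodMeasure, integral_smul_measure,
    intervalIntegral.integral_of_le two_pi_pos.le, ENNReal.toReal_inv,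
    ENNReal.toReal_ofReal two_pi_pos.le]

lemma enorm_sub_meanY_rpow_le {d : ℕ} {u : Edim d × ℝ → ℂ} (hu : Continuous u)
    (hper : ∀ x y, u (x, y + 2 * π) = u (x, y)) {q : ℝ} (hq : 1 ≤ q) (z : Edim d × ℝ) :
    ‖u z - meanY d u z‖ₑ ^ q ≤ ∫⁻ h, ‖u z - u (z + (0, h))‖ₑ ^ q ∂periodMeasure := by
  have hc : Continuous fun h => u z - u (z + (0, h)) := by fun_prop
  rw [sub_meanY_eq_integral hu hper, ← ENNReal.le_rpow_inv_iff (by linarith), ← one_div]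
  refine (enorm_integral_le_lintegral_enorm _).trans ?_
  simpa [eLpNorm'] using eLpNorm'_le_eLpNorm'_of_exponent_le zero_lt_one hq periodMeasure
    hc.aestronglyMeasurable

lemma lpPow_sub_meanY_rpow_le {d : ℕ} (hd : 2 ≤ d) {u : Edim d × ℝ → ℂ} (hu : InH1 d u)
    {A B : ℝ} (hA : 0 < A) (hB : 0 < B) (hyA : gradySq d u ^ (1 / 2 : ℝ) ≤ A)
    (hxB : gradxSq d u ^ (1 / 2 : ℝ) ≤ B) :
    lpPow d (fun z => u z - meanY d u z) (qExp d) ^ (1 / qExp d)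
      ≤ 4 * (qExp d + 2) * A ^ (1 / ((d : ℝ) + 1)) * B ^ ((d : ℝ) / (d + 1)) := by
  have hq2 := two_lt_qExp hd
  have hc := hu.2.1.continuous
  set K : ℝ := 4 * (qExp d + 2) * A ^ (1 / ((d : ℝ) + 1)) * B ^ ((d : ℝ) / (d + 1)) with hK
  have hK0 : 0 ≤ K := by positivity
  have hle : ∫⁻ z in strip d, ‖u z - meanY d u z‖ₑ ^ qExp d ≤ ENNReal.ofReal (K ^ qExp d) := by
    calc ∫⁻ z in strip d, ‖u z - meanY d u z‖ₑ ^ qExp d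
        ≤ ∫⁻ z in strip d, ∫⁻ h, ‖u z - u (z + (0, h))‖ₑ ^ qExp d ∂periodMeasure :=
          lintegral_mono fun z => enorm_sub_meanY_rpow_le hc hu.1 (by linarith) z
      _ = ∫⁻ h, (∫⁻ z in strip d, ‖u z - u (z + (0, h))‖ₑ ^ qExp d) ∂periodMeasure := by
          refine lintegral_lintegral_swap (Measurable.aemeasurable ?_)
          have : Continuous fun p : (Edim d × ℝ) × ℝ => u p.1 - u (p.1 + (0, p.2)) := by fun_prop
          exact this.measurable.enorm.pow_const _
      _ ≤ ∫⁻ _h, ENNReal.ofReal (K ^ qExp d) ∂periodMeasure := by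
          refine lintegral_mono fun h => ?_
          rw [← ENNReal.ofReal_rpow_of_nonneg hK0 (by linarith)]
          exact lintegral_sub_shift_le hd hu hA hB hyA hxB h
      _ = _ := by simp
  have hreal : lpPow d (fun z => u z - meanY d u z) (qExp d) ≤ K ^ qExp d := by
    refine (Real.le_norm_self (∫ z in strip d, ‖u z - meanY d u z‖ ^ qExp d)).trans
      ((norm_integral_le_lintegral_norm _).trans
      (ENNReal.toReal_le_of_le_ofReal (by positivity) (le_trans (le_of_eq ?_) hle)))
    refine lintegral_congr fun z => ?_
    rw [norm_of_nonneg (by positivity), ← ofReal_norm,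
      ENNReal.ofReal_rpow_of_nonneg (norm_nonneg _) (by linarith)]
  have hnn : 0 ≤ lpPow d (fun z => u z - meanY d u z) (qExp d) :=
    integral_nonneg fun z => by positivity
  calc _ ≤ (K ^ qExp d) ^ (1 / qExp d) := rpow_le_rpow hnn hreal (by positivity)
    _ = K := by rw [← rpow_mul hK0, mul_one_div_cancel (by linarith), rpow_one]

/-- `‖u − m(u)‖_{L^q} ≲ ‖∂_y u‖₂^{1/(d+1)} ‖∇ₓu‖₂^{d/(d+1)}` on `ℝ^d × 𝕋`,
with `q = 2(d+1)/(d−1)`. -/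
theorem mean_free_interpolation (d : ℕ) (hd : 2 ≤ d) :
    ∃ C : ℝ, 0 < C ∧ ∀ u : Edim d × ℝ → ℂ, InH1 d u →
      (lpPow d (fun z => u z - meanY d u z) (qExp d)) ^ (1 / qExp d)
        ≤ C * (gradySq d u) ^ (1 / (2 * ((d : ℝ) + 1))) *
            (gradxSq d u) ^ ((d : ℝ) / (2 * ((d : ℝ) + 1))) := by
  have hq2 := two_lt_qExp hd
  refine ⟨4 * (qExp d + 2), by linarith, fun u hu => ?_⟩
  have hy : 0 ≤ gradySq d u := integral_nonneg fun z => by positivity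
  have hx : 0 ≤ gradxSq d u := integral_nonneg fun z => by positivity
  have hc : Continuous fun ε : ℝ => 4 * (qExp d + 2)
      * (gradySq d u ^ (1 / 2 : ℝ) + ε) ^ (1 / ((d : ℝ) + 1))
      * (gradxSq d u ^ (1 / 2 : ℝ) + ε) ^ ((d : ℝ) / (d + 1)) :=
    (continuous_const.mul (Continuous.rpow_const (by fun_prop) fun _ => Or.inr (by positivity))).mul
      (Continuous.rpow_const (by fun_prop) fun _ => Or.inr (by positivity))
  have hlim := (hc.tendsto 0).mono_left (nhdsWithin_le_nhds (s := Ioi 0))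
  have key := ge_of_tendsto hlim (Filter.eventually_of_mem self_mem_nhdsWithin fun ε hε => by
    have hε : 0 < ε := hε
    exact lpPow_sub_meanY_rpow_le hd hu (by positivity) (by positivity)
      (le_add_of_nonneg_right hε.le) (le_add_of_nonneg_right hε.le))
  rw [add_zero, add_zero, ← rpow_mul hy, ← rpow_mul hx] at key
  rw [show 1 / (2 * ((d : ℝ) + 1)) = 1 / 2 * (1 / ((d : ℝ) + 1)) by field_simp,
    show (d : ℝ) / (2 * ((d : ℝ) + 1)) = 1 / 2 * ((d : ℝ) / ((d : ℝ) + 1)) by field_simp]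
  exact key

end
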